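/- arXiv:2512.13450 — 3 statements merged into one kernel-verified Lean document; each statement's English description precedes it below -/
import Mathlib

section
/- Let p ≥ 3 be an odd integer and let X, Y, Z be pairwise distinct complex numbers satisfying X^p = Y^p = Z^p = -1, XY ≠ 1, XZ ≠ 1, and YZ ≠ 1. Then F_p(X,Y,Z) = 0. -/
open Finset


open Finset

/-- For an odd integer `p > 1`, `T_p` is the set of triples `(j,k,ℓ)` of integers with
`0 ≤ j,k,ℓ ≤ p-2`, `j+k+ℓ` even, `j+k+ℓ ≤ 2p-4`, `ℓ ≤ j+k`, `j ≤ k+ℓ`, `k ≤ j+ℓ`,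
and `F_p(X,Y,Z) = Σ_{(j,k,ℓ) ∈ T_p} X^{j+1} Y^{k+1} Z^{ℓ+1}`. -/
noncomputable def Fp (p : ℕ) (X Y Z : ℂ) : ℂ :=
  ∑ t ∈ (Finset.range (p - 1) ×ˢ Finset.range (p - 1) ×ˢ Finset.range (p - 1)).filter
      (fun t => Even (t.1 + t.2.1 + t.2.2) ∧ t.1 + t.2.1 + t.2.2 + 4 ≤ 2 * p ∧
        t.2.2 ≤ t.1 + t.2.1 ∧ t.1 ≤ t.2.1 + t.2.2 ∧ t.2.1 ≤ t.1 + t.2.2),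
    X ^ (t.1 + 1) * Y ^ (t.2.1 + 1) * Z ^ (t.2.2 + 1)

/-- Geometric convolution sums: `S1`, `S2`, `S3` are complete homogeneous sums. -/
lemma conv_succ (f : ℕ → ℂ) (u : ℂ) (n : ℕ) :
    ∑ a ∈ range (n + 1), u ^ a * f (n + 1 - a)
      = u * ∑ a ∈ range n, u ^ a * f (n - a) + f (n + 1) := by
  rw [Finset.sum_range_succ', Finset.mul_sum]
  simp only [pow_zero, one_mul, Nat.sub_zero, Nat.add_sub_add_right]
  congr 1
  exact Finset.sum_congr rfl fun a _ => by ring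

lemma S1_closed (w : ℂ) (hw : w ≠ 1) (n : ℕ) :
    ∑ c ∈ range n, w ^ c = (w ^ n - 1) / (w - 1) := geom_sum_eq hw n

lemma S2_closed (v w : ℂ) (hv : v ≠ 1) (hw : w ≠ 1) (hvw : v ≠ w) (n : ℕ) :
    ∑ b ∈ range n, v ^ b * ∑ c ∈ range (n - b), w ^ c
      = 1 / ((1 - v) * (1 - w)) + v ^ (n + 1) / ((v - 1) * (v - w))
        - w ^ (n + 1) / ((w - 1) * (v - w)) := by
  have h1 := sub_ne_zero.2 hv
  have h2 := sub_ne_zero.2 hw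
  have h3 := sub_ne_zero.2 hvw
  have h1' := sub_ne_zero.2 hv.symm
  have h2' := sub_ne_zero.2 hw.symm
  induction n with
  | zero => simp only [range_zero, sum_empty]; field_simp; ring
  | succ n ih =>
    rw [conv_succ (fun m => ∑ c ∈ range m, w ^ c), ih, S1_closed w hw]
    field_simp
    ring

lemma S3_closed (u v w : ℂ) (hu : u ≠ 1) (hv : v ≠ 1) (hw : w ≠ 1) (huv : u ≠ v)
    (huw : u ≠ w) (hvw : v ≠ w) (n : ℕ) :
    ∑ a ∈ range n, u ^ a * ∑ b ∈ range (n - a), v ^ b * ∑ c ∈ range (n - a - b), w ^ c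
      = 1 / ((1 - u) * (1 - v) * (1 - w)) + u ^ (n + 2) / ((u - 1) * (u - v) * (u - w))
        - v ^ (n + 2) / ((v - 1) * (u - v) * (v - w))
        + w ^ (n + 2) / ((w - 1) * (u - w) * (v - w)) := by
  have h0 := sub_ne_zero.2 hu
  have h0' := sub_ne_zero.2 hu.symm
  have h1 := sub_ne_zero.2 hv
  have h2 := sub_ne_zero.2 hw
  have h3 := sub_ne_zero.2 hvw
  have h4 := sub_ne_zero.2 huv
  have h5 := sub_ne_zero.2 huw
  have h1' := sub_ne_zero.2 hv.symm
  have h2' := sub_ne_zero.2 hw.symm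
  induction n with
  | zero => simp only [range_zero, sum_empty]; field_simp; ring
  | succ n ih =>
    rw [conv_succ (fun m => ∑ b ∈ range m, v ^ b * ∑ c ∈ range (m - b), w ^ c), ih,
      S2_closed v w hv hw hvw]
    field_simp
    ring

lemma Fp_eq (p : ℕ) (X Y Z : ℂ) :
    Fp p X Y Z = X * Y * Z * ∑ a ∈ range (p - 1), (X * Y) ^ a *
      ∑ b ∈ range (p - 1 - a), (X * Z) ^ b * ∑ c ∈ range (p - 1 - a - b), (Y * Z) ^ c := by
  simp only [Finset.mul_sum]
  simp only [Finset.sum_sigma']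
  unfold Fp
  refine Finset.sum_nbij'
    (fun t => ⟨(t.1 + t.2.1 - t.2.2) / 2, (t.1 + t.2.2 - t.2.1) / 2, (t.2.1 + t.2.2 - t.1) / 2⟩)
    (fun s => (s.1 + s.2.1, s.1 + s.2.2, s.2.1 + s.2.2)) ?_ ?_ ?_ ?_ ?_
  · rintro ⟨j, k, l⟩ h
    simp only [mem_filter, mem_product, mem_range, mem_sigma, Nat.even_iff] at h ⊢
    omega
  · rintro ⟨a, b, c⟩ h
    simp only [mem_filter, mem_product, mem_range, mem_sigma, Nat.even_iff] at h ⊢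
    omega
  · rintro ⟨j, k, l⟩ h
    simp only [mem_filter, mem_product, mem_range, Nat.even_iff] at h
    simp only [Prod.mk.injEq]
    omega
  · rintro ⟨a, b, c⟩ h
    have e1 : (a + b + (a + c) - (b + c)) / 2 = a := by omega
    have e2 : (a + b + (b + c) - (a + c)) / 2 = b := by omega
    have e3 : (a + c + (b + c) - (a + b)) / 2 = c := by omega
    simp only [e1, e2, e3]
  · rintro ⟨j, k, l⟩ h
    simp only [mem_filter, mem_product, mem_range, Nat.even_iff] at h
    obtain ⟨a, b, c, rfl, rfl, rfl⟩ : ∃ a b c, j = a + b ∧ k = a + c ∧ l = b + c :=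
      ⟨(j + k - l) / 2, (j + l - k) / 2, (k + l - j) / 2, by omega, by omega, by omega⟩
    have e1 : (a + b + (a + c) - (b + c)) / 2 = a := by omega
    have e2 : (a + b + (b + c) - (a + c)) / 2 = b := by omega
    have e3 : (a + c + (b + c) - (a + b)) / 2 = c := by omega
    simp only [e1, e2, e3]
    ring

/-- If `X,Y,Z` are pairwise distinct `p`-th roots of `-1` with
`XY ≠ 1`, `XZ ≠ 1`, `YZ ≠ 1`, then `F_p(X,Y,Z) = 0`. -/
theorem stmt_2 (p : ℕ) (hp : Odd p) (hp3 : 3 ≤ p) (X Y Z : ℂ)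
    (hXp : X ^ p = -1) (hYp : Y ^ p = -1) (hZp : Z ^ p = -1)
    (hXY : X ≠ Y) (hXZ : X ≠ Z) (hYZ : Y ≠ Z)
    (hXY1 : X * Y ≠ 1) (hXZ1 : X * Z ≠ 1) (hYZ1 : Y * Z ≠ 1) :
    Fp p X Y Z = 0 := by
  have hp0 : p ≠ 0 := by omega
  have hX : X ≠ 0 := by rintro rfl; simp [hp0] at hXp
  have hY : Y ≠ 0 := by rintro rfl; simp [hp0] at hYp
  have hZ : Z ≠ 0 := by rintro rfl; simp [hp0] at hZp
  have huv : X * Y ≠ X * Z := fun h => hYZ (mul_left_cancel₀ hX h)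
  have huw : X * Y ≠ Y * Z := fun h => hXZ (mul_left_cancel₀ hY (by rw [← h]; ring))
  have hvw : X * Z ≠ Y * Z := fun h => hXY (mul_right_cancel₀ hZ h)
  have hu : (X * Y) ^ p = 1 := by rw [mul_pow, hXp, hYp]; norm_num
  have hv : (X * Z) ^ p = 1 := by rw [mul_pow, hXp, hZp]; norm_num
  have hw : (Y * Z) ^ p = 1 := by rw [mul_pow, hYp, hZp]; norm_num
  rw [Fp_eq, S3_closed _ _ _ hXY1 hXZ1 hYZ1 huv huw hvw]
  have e : p - 1 + 2 = p + 1 := by omega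
  rw [e, pow_succ, pow_succ, pow_succ, hu, hv, hw]
  generalize X * Y = u at *
  generalize X * Z = v at *
  generalize Y * Z = w at *
  have h0 := sub_ne_zero.2 hXY1
  have h0' := sub_ne_zero.2 hXY1.symm
  have h1 := sub_ne_zero.2 hXZ1
  have h2 := sub_ne_zero.2 hYZ1
  have h3 := sub_ne_zero.2 hvw
  have h4 := sub_ne_zero.2 huv
  have h5 := sub_ne_zero.2 huw
  have h1' := sub_ne_zero.2 hXZ1.symm
  have h2' := sub_ne_zero.2 hYZ1.symm
  refine mul_eq_zero_of_right _ ?_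
  field_simp
  ring
end

section
/- Let p ≥ 3 be an odd integer and let X be a complex number satisfying X^p = -1 and X² ≠ 1. Then F_p(X,X,X) = p · ((p-1)X - (p+1)X⁻¹) / (2 (X - X⁻¹)²). -/
open Finset


open Finset

theorem aux_reindex (p : ℕ) (X : ℂ) :
    Fp p X X X = ∑ s ∈ Finset.range (p - 1), ∑ j ∈ Finset.range (s + 1),
      ∑ _a ∈ Finset.range (j + 1), X ^ (2 * s + 3) := by
  unfold Fp
  simp_rw [Finset.sum_sigma']
  refine Finset.sum_bij'
    (fun t _ => ⟨(t.1 + t.2.1 + t.2.2) / 2, ⟨t.1, (t.1 + t.2.1 - t.2.2) / 2⟩⟩)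
    (fun x _ => (x.2.1, x.1 - (x.2.1 - x.2.2), x.1 - x.2.2)) ?_ ?_ ?_ ?_ ?_
  · rintro ⟨j, k, l⟩ h
    simp only [Finset.mem_filter, Finset.mem_product, Finset.mem_range, Finset.mem_sigma,
      Nat.even_iff] at h ⊢
    omega
  · rintro ⟨s, j, a⟩ h
    simp only [Finset.mem_filter, Finset.mem_product, Finset.mem_range, Finset.mem_sigma,
      Nat.even_iff] at h ⊢
    omega
  · rintro ⟨j, k, l⟩ h
    simp only [Finset.mem_filter, Finset.mem_product, Finset.mem_range, Nat.even_iff] at h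
    simp only [Prod.mk.injEq, true_and]
    omega
  · rintro ⟨s, j, a⟩ h
    simp only [Finset.mem_range, Finset.mem_sigma] at h
    have h1 : (j + (s - (j - a)) + (s - a)) / 2 = s := by omega
    have h2 : (j + (s - (j - a)) - (s - a)) / 2 = a := by omega
    simp only [h1, h2]
  · rintro ⟨j, k, l⟩ h
    simp only [Finset.mem_filter, Finset.mem_product, Finset.mem_range, Nat.even_iff] at h
    simp only [← pow_add]
    congr 1
    omega

theorem aux_tri (s : ℕ) (c : ℂ) :
    ∑ j ∈ Finset.range (s + 1), ∑ _a ∈ Finset.range (j + 1), c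
      = ((s : ℂ) + 1) * (s + 2) / 2 * c := by
  induction s with
  | zero => simp
  | succ n ih =>
    rw [Finset.sum_range_succ, ih]
    simp only [Finset.sum_const, Finset.card_range, nsmul_eq_mul]
    push_cast
    ring

theorem aux_closed (n : ℕ) (X : ℂ) :
    (∑ s ∈ Finset.range n, ((s : ℂ) + 1) * (s + 2) / 2 * X ^ (2 * s + 3)) * (2 * (1 - X ^ 2) ^ 3)
      = X ^ 3 * (2 - X ^ (2 * n) * (((n : ℂ) + 1) * (n + 2) - 2 * n * (n + 2) * X ^ 2
        + n * (n + 1) * X ^ 4)) := by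
  induction n with
  | zero => simp
  | succ n ih =>
    rw [Finset.sum_range_succ, add_mul, ih]
    push_cast
    ring

/-- If `X^p = -1` and `X² ≠ 1`, then
`F_p(X,X,X) = p((p-1)X - (p+1)X⁻¹)/(2(X - X⁻¹)²)`. -/
theorem stmt_5 (p : ℕ) (hp : Odd p) (hp3 : 3 ≤ p) (X : ℂ)
    (hXp : X ^ p = -1) (hX2 : X ^ 2 ≠ 1) :
    Fp p X X X = (p : ℂ) * (((p : ℂ) - 1) * X - ((p : ℂ) + 1) * X⁻¹) /
      (2 * (X - X⁻¹) ^ 2) := by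
  have hX0 : X ≠ 0 := by
    rintro rfl
    rw [zero_pow (by omega)] at hXp
    norm_num at hXp
  have h1 : (1 - X ^ 2) ≠ 0 := sub_ne_zero.mpr (Ne.symm hX2)
  obtain ⟨n, rfl⟩ : ∃ n, p = n + 1 := ⟨p - 1, by omega⟩
  have hc := aux_closed n X
  rw [aux_reindex]
  simp_rw [aux_tri]
  rw [Nat.add_sub_cancel]
  set S := ∑ s ∈ Finset.range n, ((s : ℂ) + 1) * (s + 2) / 2 * X ^ (2 * s + 3)
  have hy : X ^ (2 * n) * X ^ 2 = 1 := by
    have : X ^ (2 * n) * X ^ 2 = (X ^ (n + 1)) ^ 2 := by ring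
    rw [this, hXp]; norm_num
  have hd : X - X⁻¹ = -(1 - X ^ 2) / X := by field_simp; ring
  have hS : S * (2 * (1 - X ^ 2) ^ 2)
      = X * (((n : ℂ) + 1) * (n * X ^ 2 - (n + 2))) := by
    apply mul_right_cancel₀ h1
    apply mul_right_cancel₀ (pow_ne_zero 2 hX0)
    linear_combination X ^ 2 * hc - X ^ 3 * (((n : ℂ) + 1) * (n + 2) - 2 * n * (n + 2) * X ^ 2
        + n * (n + 1) * X ^ 4) * hy
  rw [hd]
  push_cast
  rw [eq_div_iff (by
    refine mul_ne_zero two_ne_zero (pow_ne_zero 2 (div_ne_zero (neg_ne_zero.mpr h1) hX0)))]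
  field_simp
  linear_combination hS
end

section
/- Let q, p be coprime integers with p > 0 and q odd. Then S(q/p) = 4·s(q, 2p) - 2·s(q, p), i.e., S is the 2-smoothed Dedekind sum. -/
open Real Finset

/-- `S(q/p) = (1/2) Σ_{n=1}^{p-1} (-1)^{⌊nq/p⌋}` for coprime `q, p` with `p > 0`, `q` odd. -/
noncomputable def Sfun (q p : ℤ) : ℝ :=
  (1 / 2) * ∑ n ∈ Finset.Icc (1 : ℤ) (p - 1), (-1 : ℝ) ^ ⌊((n * q : ℤ) : ℝ) / (p : ℝ)⌋

/-- The classical Dedekind sum `s(q,p) = (1/(4p)) Σ_{n=1}^{p-1} cot(πn/p) cot(πnq/p)`. -/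
noncomputable def dedekindSum (q p : ℤ) : ℝ :=
  (1 / (4 * (p : ℝ))) * ∑ n ∈ Finset.Icc (1 : ℤ) (p - 1),
    Real.cot (π * n / (p : ℝ)) * Real.cot (π * n * q / (p : ℝ))

lemma aux_sum_Icc (g : ℤ → ℝ) (m : ℕ) :
    ∑ n ∈ Finset.Icc (1 : ℤ) (m : ℤ), g n = ∑ n ∈ Finset.range m, g ((n : ℤ) + 1) := by
  induction m with
  | zero => simp
  | succ m ih =>
    have h : Finset.Icc (1 : ℤ) ((m + 1 : ℕ) : ℤ) =
        insert ((m : ℤ) + 1) (Finset.Icc (1 : ℤ) (m : ℤ)) := by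
      ext x; simp only [Finset.mem_Icc, Finset.mem_insert]; push_cast; omega
    rw [h, Finset.sum_insert (by simp), ih, Finset.sum_range_succ, add_comm]

lemma aux_sum_Icc' (g : ℤ → ℝ) (h0 : g 0 = 0) (P : ℕ) (hP : 0 < P) :
    ∑ n ∈ Finset.Icc (1 : ℤ) ((P : ℤ) - 1), g n = ∑ n ∈ Finset.range P, g (n : ℤ) := by
  obtain ⟨m, rfl⟩ : ∃ m, P = m + 1 := ⟨P - 1, by omega⟩
  have : (((m + 1 : ℕ) : ℤ) - 1) = (m : ℤ) := by push_cast; ring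
  rw [this, aux_sum_Icc, Finset.sum_range_succ']
  simp [h0]

lemma aux_split (g : ℕ → ℝ) (P : ℕ) :
    ∑ n ∈ Finset.range (2 * P), g n =
      ∑ j ∈ Finset.range P, g (2 * j) + ∑ j ∈ Finset.range P, g (2 * j + 1) := by
  induction P with
  | zero => simp
  | succ P ih =>
    rw [show 2 * (P + 1) = 2 * P + 1 + 1 by ring, Finset.sum_range_succ, Finset.sum_range_succ, ih,
      Finset.sum_range_succ, Finset.sum_range_succ]
    ring

/-- `sin (π k / 2P) ≠ 0` for odd `k`. -/
lemma aux_sin_ne (k : ℤ) (hk : Odd k) (P : ℕ) (hP : 0 < P) :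
    Real.sin (π * k / (2 * P)) ≠ 0 := by
  intro h
  obtain ⟨n, hn⟩ := Real.sin_eq_zero_iff.mp h
  have hP' : (P : ℝ) ≠ 0 := by positivity
  have hpi := Real.pi_ne_zero
  field_simp at hn
  have h2 : n * 2 * (P : ℤ) = k := by
    have : ((n * 2 * (P : ℤ) : ℤ) : ℝ) = (k : ℝ) := by push_cast; linarith
    exact_mod_cast this
  obtain ⟨r, hr⟩ := hk
  have : 2 * (n * (P : ℤ)) = 2 * r + 1 := by rw [← hr, ← h2]; ring
  omega

lemma aux_tele_sin (θ : ℝ) (P : ℕ) :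
    2 * Real.sin (θ / 2) * ∑ n ∈ Finset.range P, Real.sin (θ * n) =
      Real.cos (θ / 2) - Real.cos (P * θ - θ / 2) := by
  induction P with
  | zero => simp
  | succ P ih =>
    rw [Finset.sum_range_succ, mul_add, ih]
    have e1 : ((P + 1 : ℕ) : ℝ) * θ - θ / 2 = θ * P + θ / 2 := by push_cast; ring
    have e2 : (P : ℝ) * θ - θ / 2 = θ * P - θ / 2 := by ring
    rw [e1, e2, Real.cos_add, Real.cos_sub]
    ring

lemma aux_A (k : ℤ) (hk : Odd k) (P : ℕ) (hP : 0 < P) :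
    ∑ n ∈ Finset.range P, Real.sin (π * k / P * n) = Real.cot (π * k / (2 * P)) := by
  have hs := aux_sin_ne k hk P hP
  have h := aux_tele_sin (π * k / P) P
  have hP' : (P : ℝ) ≠ 0 := by positivity
  have e1 : π * k / P / 2 = π * k / (2 * P) := by field_simp
  have e2 : (P : ℝ) * (π * k / P) = k * π := by field_simp
  rw [e1, e2, Real.cos_int_mul_pi_sub, hk.neg_one_zpow] at h
  rw [Real.cot_eq_cos_div_sin, eq_div_iff hs]
  linarith

lemma aux_tele_cos (φ : ℝ) (P : ℕ) :
    2 * Real.sin φ * ∑ j ∈ Finset.range P, Real.cos ((2 * j + 1) * φ) =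
      Real.sin (2 * P * φ) := by
  induction P with
  | zero => simp
  | succ P ih =>
    rw [Finset.sum_range_succ, mul_add, ih]
    have e1 : 2 * ((P + 1 : ℕ) : ℝ) * φ = (2 * P + 1) * φ + φ := by push_cast; ring
    have e2 : 2 * (P : ℝ) * φ = (2 * P + 1) * φ - φ := by ring
    rw [e1, e2, Real.sin_add, Real.sin_sub]
    ring

lemma aux_cos_zero (P x : ℕ) (hx : 0 < x) (hxP : x < P) :
    ∑ j ∈ Finset.range P, Real.cos ((2 * j + 1) * (π * x / P)) = 0 := by
  have h := aux_tele_cos (π * x / P) P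
  have hP0 : (0 : ℝ) < P := by exact_mod_cast (by omega : 0 < P)
  have hx0 : (0 : ℝ) < x := by exact_mod_cast hx
  have hxP' : (x : ℝ) < P := by exact_mod_cast hxP
  have e : 2 * (P : ℝ) * (π * x / P) = ((2 * x : ℕ) : ℝ) * π := by push_cast; field_simp
  rw [e, Real.sin_nat_mul_pi] at h
  have hs : 0 < Real.sin (π * x / P) := by
    apply Real.sin_pos_of_pos_of_lt_pi
    · positivity
    · rw [div_lt_iff₀ hP0]; exact mul_lt_mul_of_pos_left hxP' Real.pi_pos
  rcases mul_eq_zero.mp h with h | h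
  · linarith
  · exact h

noncomputable def auxT (P : ℕ) (x : ℤ) : ℝ :=
  ∑ j ∈ Finset.range P, Real.cot (π * ((2 * j + 1 : ℤ) : ℝ) / (2 * P)) *
    Real.sin (π * ((2 * j + 1 : ℤ) : ℝ) * x / P)

lemma auxT_step (P : ℕ) (hP : 0 < P) (x : ℕ) :
    auxT P ((x : ℤ) + 1) = auxT P x +
      ∑ j ∈ Finset.range P, Real.cos ((2 * j + 1) * (π * x / P)) +
      ∑ j ∈ Finset.range P, Real.cos ((2 * j + 1) * (π * (x + 1 : ℕ) / P)) := by
  unfold auxT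
  rw [← Finset.sum_add_distrib, ← Finset.sum_add_distrib]
  refine Finset.sum_congr rfl fun j _ => ?_
  have hP' : (P : ℝ) ≠ 0 := by positivity
  have hs := aux_sin_ne (2 * j + 1) ⟨j, rfl⟩ P hP
  rw [Real.cot_eq_cos_div_sin]
  push_cast at hs ⊢
  set α := π * (2 * (j : ℝ) + 1) / (2 * P) with hα
  set β := α * (2 * x + 1) with hβ
  have e1 : π * (2 * (j : ℝ) + 1) * ((x : ℝ) + 1) / P = β + α := by
    rw [hβ, hα]; field_simp; ring
  have e2 : π * (2 * (j : ℝ) + 1) * (x : ℝ) / P = β - α := by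
    rw [hβ, hα]; field_simp; ring
  have e3 : (2 * (j : ℝ) + 1) * (π * x / P) = β - α := by
    rw [hβ, hα]; field_simp; ring
  have e4 : (2 * (j : ℝ) + 1) * (π * ((x : ℝ) + 1) / P) = β + α := by
    rw [hβ, hα]; field_simp; ring
  rw [e1, e2, e3, e4, Real.sin_add, Real.sin_sub, Real.cos_add, Real.cos_sub]
  field_simp
  ring

lemma auxT_base (P : ℕ) (x : ℕ) (hx : x + 1 < P) : auxT P ((x : ℤ) + 1) = P := by
  induction x with
  | zero =>
    rw [auxT_step P (by omega) 0, aux_cos_zero P (0 + 1) (by omega) hx]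
    simp [auxT]
  | succ x ih =>
    rw [auxT_step P (by omega) (x + 1), aux_cos_zero P (x + 1 + 1) (by omega) hx,
      aux_cos_zero P (x + 1) (by omega) (by omega)]
    have := ih (by omega)
    push_cast
    rw [this]; ring

lemma auxT_shift (P : ℕ) (hP : 0 < P) (x m : ℤ) :
    auxT P (x + m * P) = (-1 : ℝ) ^ m * auxT P x := by
  unfold auxT
  rw [Finset.mul_sum]
  refine Finset.sum_congr rfl fun j _ => ?_
  have hP' : (P : ℝ) ≠ 0 := by positivity
  have e : π * ((2 * j + 1 : ℤ) : ℝ) * ((x + m * P : ℤ) : ℝ) / P =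
      π * ((2 * j + 1 : ℤ) : ℝ) * x / P + (((2 * j + 1) * m : ℤ) : ℝ) * π := by
    push_cast; field_simp
  have ho : Odd (2 * (j : ℤ) + 1) := ⟨j, rfl⟩
  rw [e, Real.sin_add_int_mul_pi, zpow_mul, ho.neg_one_zpow]
  ring

lemma auxT_eval (P : ℕ) (hP : 0 < P) (x : ℤ) (hx : ¬ (P : ℤ) ∣ x) :
    auxT P x = (-1 : ℝ) ^ ⌊(x : ℝ) / (P : ℝ)⌋ * P := by
  have hfl : ⌊(x : ℝ) / (P : ℝ)⌋ = x / (P : ℤ) := by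
    have := Rat.floor_intCast_div_natCast x P
    rw [← this, ← Rat.floor_cast (α := ℝ)]
    push_cast; rfl
  have hPz : (0 : ℤ) < P := by exact_mod_cast hP
  have h1 := Int.emod_nonneg x hPz.ne'
  have h2 := Int.emod_lt_of_pos x hPz
  have h3 : x % P ≠ 0 := fun h => hx (Int.dvd_of_emod_eq_zero h)
  obtain ⟨r, hr⟩ : ∃ r : ℕ, x % P = (r : ℤ) + 1 := ⟨(x % P - 1).toNat, by omega⟩
  have hdec : x = ((r : ℤ) + 1) + (x / P) * P := by
    rw [← hr]; exact (Int.emod_add_ediv_mul x P).symm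
  rw [hfl]
  conv_lhs => rw [hdec]
  rw [auxT_shift P hP, auxT_base P r (by omega)]

/-- Proposition 6.1. `S` is the 2-smoothed Dedekind sum:
`S(q/p) = 4·s(q,2p) - 2·s(q,p)`. -/
theorem stmt_13 (q p : ℤ) (hp : 0 < p) (hco : IsCoprime q p) (hodd : Odd q) :
    Sfun q p = 4 * dedekindSum q (2 * p) - 2 * dedekindSum q p := by
  obtain ⟨P, rfl⟩ : ∃ P : ℕ, p = P := ⟨p.toNat, by omega⟩
  have hP : 0 < P := by exact_mod_cast hp
  have hP' : (P : ℝ) ≠ 0 := by positivity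
  -- left side
  have hL : ∑ n ∈ Finset.Icc (1 : ℤ) ((P : ℤ) - 1),
      (-1 : ℝ) ^ ⌊((n * q : ℤ) : ℝ) / ((P : ℤ) : ℝ)⌋ =
      (1 / P) * ∑ n ∈ Finset.range P, auxT P ((n : ℤ) * q) := by
    rw [← aux_sum_Icc' (fun n => auxT P (n * q)) (by simp [auxT]) P hP, Finset.mul_sum]
    refine Finset.sum_congr rfl fun n hn => ?_
    rw [Finset.mem_Icc] at hn
    have hnd : ¬ (P : ℤ) ∣ n * q := by
      intro h
      have := Int.le_of_dvd (by omega) (hco.symm.dvd_of_dvd_mul_right h)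
      omega
    rw [auxT_eval P hP _ hnd]
    simp only [Int.cast_natCast]
    field_simp
  have hS : ∑ n ∈ Finset.range P, auxT P ((n : ℤ) * q) =
      ∑ j ∈ Finset.range P, Real.cot (π * ((2 * j + 1 : ℤ) : ℝ) / (2 * P)) *
        Real.cot (π * ((2 * j + 1 : ℤ) : ℝ) * q / (2 * P)) := by
    unfold auxT
    rw [Finset.sum_comm]
    refine Finset.sum_congr rfl fun j _ => ?_
    have ho : Odd ((2 * (j : ℤ) + 1) * q) := Odd.mul ⟨j, rfl⟩ hodd
    have hA := aux_A _ ho P hP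
    rw [← Finset.mul_sum]
    congr 1
    rw [show π * ((2 * j + 1 : ℤ) : ℝ) * q / (2 * P) =
      π * (((2 * (j : ℤ) + 1) * q : ℤ) : ℝ) / (2 * P) by push_cast; ring, ← hA]
    refine Finset.sum_congr rfl fun n _ => ?_
    congr 1
    push_cast
    ring
  have hcot0 : Real.cot 0 = 0 := by simp [Real.cot_eq_cos_div_sin]
  have hD1 := aux_sum_Icc' (fun n : ℤ => Real.cot (π * n / ((P : ℤ) : ℝ)) *
    Real.cot (π * n * q / ((P : ℤ) : ℝ))) (by simp [hcot0]) P hP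
  have hD2 := aux_sum_Icc' (fun n : ℤ => Real.cot (π * n / ((2 * (P : ℤ) : ℤ) : ℝ)) *
    Real.cot (π * n * q / ((2 * (P : ℤ) : ℤ) : ℝ))) (by simp [hcot0]) (2 * P) (by omega)
  rw [aux_split] at hD2
  have hc : (((2 * P : ℕ) : ℤ) - 1) = 2 * (P : ℤ) - 1 := by push_cast; ring
  rw [hc] at hD2
  unfold Sfun dedekindSum
  rw [hL, hS, hD1, hD2]
  have hE : ∑ j ∈ Finset.range P,
      Real.cot (π * (((2 * j : ℕ) : ℤ) : ℝ) / ((2 * (P : ℤ) : ℤ) : ℝ)) *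
        Real.cot (π * (((2 * j : ℕ) : ℤ) : ℝ) * q / ((2 * (P : ℤ) : ℤ) : ℝ)) =
      ∑ j ∈ Finset.range P, Real.cot (π * ((j : ℤ) : ℝ) / ((P : ℤ) : ℝ)) *
        Real.cot (π * ((j : ℤ) : ℝ) * q / ((P : ℤ) : ℝ)) := by
    refine Finset.sum_congr rfl fun j _ => ?_
    congr 2
    · push_cast; field_simp
    · push_cast; field_simp
  rw [hE]
  push_cast
  generalize ∑ j ∈ Finset.range P, Real.cot (π * (2 * (j : ℝ) + 1) / (2 * P)) *
    Real.cot (π * (2 * (j : ℝ) + 1) * q / (2 * P)) = A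
  generalize ∑ j ∈ Finset.range P, Real.cot (π * (j : ℝ) / P) *
    Real.cot (π * (j : ℝ) * q / P) = B
  field_simp
  ring
end
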